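/- Under the hypotheses that each subsystem x_i⁺ = f_i(x_i,u_i), y_i = h_i(x_i) (f_i continuous, f_i(0,0)=0, h_i continuous, h_i(0)=0) is (Q_i,S_i,R_i)-dissipative on all of ℝⁿ with a continuous positive definite storage function V_i, that each V_i is radially unbounded (V_i(ξ) → ∞ as ‖ξ‖ → ∞), that each subsystem is zero-state detectable (every sequence (ξ_k) with ξ_{k+1} = f_i(ξ_k,0) and h_i(ξ_k) = 0 for all k satisfies ξ_k → 0), and that Q + SH + HᵀSᵀ + HᵀRH ≺ 0 with Q = diag(Q₁,…,Q_N), S = diag(S₁,…,S_N), R = diag(R₁,…,R_N), the origin of the network x⁺ = F(x), F(x)_i = f_i(x_i,(Hh(x))_i), is globally asymptotically stable: it is stable and F^{(k)}(x₀) → 0 as k → ∞ for every initial condition x₀ ∈ ℝ^{Nn}. -/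

import Mathlib

open Matrix

/-- Block-diagonal matrix built from `N` blocks of size `a × b`. -/
def blkDiag {N a b : ℕ} (M : Fin N → Matrix (Fin a) (Fin b) ℝ) :
    Matrix (Fin N × Fin a) (Fin N × Fin b) ℝ :=
  Matrix.of fun x y => if x.1 = y.1 then M x.1 x.2 y.2 else 0

open Filter Topology

section Lyapunov

variable {E : Type*} [NormedAddCommGroup E]

/-- Small values of a proper positive definite function force small arguments. -/
theorem exists_pos_forall_lt_imp_norm_lt {W : E → ℝ} (hWc : Continuous W)
    (hWpos : ∀ x, x ≠ 0 → 0 < W x) (hWrad : Tendsto W (cocompact E) atTop)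
    {ε : ℝ} (hε : 0 < ε) : ∃ c > 0, ∀ x, W x < c → ‖x‖ < ε := by
  by_cases hne : ∃ x₀ : E, ε ≤ ‖x₀‖
  · obtain ⟨x₀, hx₀⟩ := hne
    have hcl : IsClosed {x : E | ε ≤ ‖x‖} := isClosed_le continuous_const continuous_norm
    obtain ⟨z, hz, hmin⟩ := hWc.continuousOn.exists_isMinOn' hcl hx₀
      ((hWrad.eventually_ge_atTop (W x₀)).filter_mono inf_le_left)
    refine ⟨W z, hWpos z ?_, fun x hx => ?_⟩
    · rintro rfl
      simp only [Set.mem_ofPred_eq, norm_zero] at hz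
      linarith
    · by_contra! hxε
      exact absurd (hmin hxε) (not_le.mpr hx)
  · push Not at hne
    exact ⟨1, one_pos, fun x _ => hne x⟩

/-- Global Lyapunov theorem for discrete-time systems, with LaSalle's invariance principle. -/
theorem globally_asymptotically_stable_of_lyapunov {F : E → E} (hFc : Continuous F)
    {W : E → ℝ} (hWc : Continuous W) (hW0 : W 0 = 0) (hWpos : ∀ x, x ≠ 0 → 0 < W x)
    (hWrad : Tendsto W (cocompact E) atTop) (hdec : ∀ x, W (F x) ≤ W x)
    (hinv : ∀ x, (∀ k, W (F^[k] x) = W x) → Tendsto (fun k => F^[k] x) atTop (𝓝 0)) :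
    (F 0 = 0 ∧ ∀ ε > (0 : ℝ), ∃ δ > (0 : ℝ), ∀ x₀, ‖x₀‖ ≤ δ → ∀ k : ℕ, ‖F^[k] x₀‖ ≤ ε) ∧
      ∀ x₀, Tendsto (fun k : ℕ => F^[k] x₀) atTop (𝓝 0) := by
  have hWnn : ∀ x, 0 ≤ W x := fun x => by
    by_cases hx : x = 0
    · rw [hx, hW0]
    · exact (hWpos x hx).le
  have hanti : ∀ x, Antitone fun k => W (F^[k] x) := fun x =>
    antitone_nat_of_succ_le fun k => by
      rw [Function.iterate_succ_apply']
      exact hdec _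
  have hle : ∀ x k, W (F^[k] x) ≤ W x := fun x k => hanti x (Nat.zero_le k)
  refine ⟨⟨?_, fun ε hε => ?_⟩, fun x₀ => ?_⟩
  · by_contra hne
    have h₁ := hWpos _ hne
    have h₂ := hdec 0
    linarith
  · obtain ⟨c, hc, hcε⟩ := exists_pos_forall_lt_imp_norm_lt hWc hWpos hWrad hε
    have hev : ∀ᶠ x in 𝓝 (0 : E), W x < c :=
      hWc.continuousAt.eventually_lt_const (by rwa [hW0])
    obtain ⟨δ, hδ, hball⟩ := Metric.eventually_nhds_iff.mp hev
    refine ⟨δ / 2, half_pos hδ, fun x₀ hx₀ k => (hcε _ ((hle x₀ k).trans_lt (hball ?_))).le⟩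
    rw [dist_zero_right]
    linarith
  · have hlim : Tendsto (fun k => W (F^[k] x₀)) atTop (𝓝 (⨅ k, W (F^[k] x₀))) :=
      tendsto_atTop_ciInf (hanti x₀) ⟨0, by rintro _ ⟨k, rfl⟩; exact hWnn _⟩
    obtain ⟨K, hK, hKsub⟩ := mem_cocompact.mp (hWrad.eventually_gt_atTop (W x₀))
    have horbit : ∀ k, F^[k] x₀ ∈ K := fun k => by
      by_contra hk
      exact absurd (hKsub hk) (not_lt.mpr (hle x₀ k))
    obtain ⟨z, -, φ, hφ, hz⟩ := hK.tendsto_subseq horbit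
    have hWz : ∀ j, W (F^[j] z) = ⨅ k, W (F^[k] x₀) := fun j => by
      have h₁ : Tendsto (fun k => W (F^[j] (F^[φ k] x₀))) atTop (𝓝 (W (F^[j] z))) :=
        ((hWc.comp (hFc.iterate j)).tendsto z).comp hz
      have h₂ : Tendsto (fun k => W (F^[j] (F^[φ k] x₀))) atTop
          (𝓝 (⨅ k, W (F^[k] x₀))) := by
        simp only [← Function.iterate_add_apply]
        exact hlim.comp (tendsto_atTop_mono (fun k => Nat.le_add_left _ _) hφ.tendsto_atTop)
      exact tendsto_nhds_unique h₁ h₂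
    have hzero : (⨅ k, W (F^[k] x₀)) = 0 := by
      have h₁ := (hWc.tendsto 0).comp (hinv z fun k => (hWz k).trans (hWz 0).symm)
      rw [hW0] at h₁
      exact tendsto_nhds_unique (tendsto_const_nhds.congr fun k => (hWz k).symm) h₁
    rw [hzero] at hlim
    rw [NormedAddGroup.tendsto_nhds_zero]
    intro ε hε
    obtain ⟨c, hc, hcε⟩ := exists_pos_forall_lt_imp_norm_lt hWc hWpos hWrad hε
    exact (hlim.eventually_lt_const hc).mono fun k hk => hcε _ hk

end Lyapunov

theorem dotProduct_blkDiag_mulVec {N a b : ℕ} (M : Fin N → Matrix (Fin a) (Fin b) ℝ)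
    (y : Fin N × Fin a → ℝ) (z : Fin N × Fin b → ℝ) :
    y ⬝ᵥ (blkDiag M *ᵥ z) =
      ∑ i, (fun c => y (i, c)) ⬝ᵥ (M i *ᵥ fun d => z (i, d)) := by
  simp [dotProduct, mulVec, blkDiag, Fintype.sum_prod_type, ite_mul, Finset.sum_ite_irrel]

/-- The supply rate of an interconnection `u = Hy` as a quadratic form in the outputs. -/
theorem dotProduct_closedLoop_mulVec {ι κ : Type*} [Fintype ι] [Fintype κ]
    (Q : Matrix ι ι ℝ) (S : Matrix ι κ ℝ) (R : Matrix κ κ ℝ) (H : Matrix κ ι ℝ) (y : ι → ℝ) :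
    y ⬝ᵥ ((Q + S * H + Hᵀ * Sᵀ + Hᵀ * R * H) *ᵥ y) =
      y ⬝ᵥ (Q *ᵥ y) + 2 * (y ⬝ᵥ (S *ᵥ (H *ᵥ y))) + (H *ᵥ y) ⬝ᵥ (R *ᵥ (H *ᵥ y)) := by
  have h₁ : y ⬝ᵥ ((Hᵀ * Sᵀ) *ᵥ y) = y ⬝ᵥ (S *ᵥ (H *ᵥ y)) := by
    rw [← transpose_mul, mulVec_transpose, dotProduct_comm, ← dotProduct_mulVec,
      ← mulVec_mulVec]
  have h₂ : y ⬝ᵥ ((Hᵀ * R * H) *ᵥ y) = (H *ᵥ y) ⬝ᵥ (R *ᵥ (H *ᵥ y)) := by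
    rw [← mulVec_mulVec, ← mulVec_mulVec, dotProduct_mulVec, vecMul_transpose]
  rw [add_mulVec, add_mulVec, add_mulVec, dotProduct_add, dotProduct_add, dotProduct_add,
    h₁, h₂, ← mulVec_mulVec]
  ring

/-- A sum of nonnegative radially unbounded functions of the blocks is radially unbounded. -/
theorem tendsto_sum_blocks_cocompact {N n : ℕ} {V : Fin N → (Fin n → ℝ) → ℝ}
    (hVnn : ∀ i ξ, 0 ≤ V i ξ) (hVrad : ∀ i, Tendsto (V i) (comap norm atTop) atTop) :
    Tendsto (fun x : Fin N × Fin n → ℝ => ∑ i, V i fun a => x (i, a))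
      (cocompact (Fin N × Fin n → ℝ)) atTop := by
  rw [tendsto_atTop]
  intro b
  have hr : ∀ i, ∃ r : ℝ, ∀ ξ : Fin n → ℝ, r ≤ ‖ξ‖ → b ≤ V i ξ := fun i => by
    obtain ⟨r, hr⟩ := eventually_atTop.mp
      (eventually_comap.mp ((hVrad i).eventually_ge_atTop b))
    exact ⟨r, fun ξ hξ => hr _ hξ ξ rfl⟩
  choose r hr using hr
  filter_upwards [(tendsto_norm_cocompact_atTop (E := Fin N × Fin n → ℝ)).eventually_gt_atTop
    (∑ i, |r i|)] with x hx
  have hnn : 0 ≤ ∑ i, |r i| := Finset.sum_nonneg fun i _ => abs_nonneg _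
  have hex : ∃ q, ∑ i, |r i| < ‖x q‖ := by
    by_contra! hq
    exact absurd ((pi_norm_le_iff_of_nonneg hnn).mpr hq) (not_le.mpr hx)
  obtain ⟨⟨i, a⟩, hia⟩ := hex
  have h₁ : |r i| ≤ ∑ i, |r i| :=
    Finset.single_le_sum (f := fun i => |r i|) (fun j _ => abs_nonneg _) (Finset.mem_univ i)
  have h₂ : ‖x (i, a)‖ ≤ ‖fun a => x (i, a)‖ := norm_le_pi_norm (fun a => x (i, a)) a
  exact (hr i _ (by linarith [le_abs_self (r i)])).trans
    (Finset.single_le_sum (f := fun i => V i fun a => x (i, a)) (fun j _ => hVnn j _)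
      (Finset.mem_univ i))

/-- Interconnection of globally (Q_i,S_i,R_i)-dissipative, zero-state detectable nonlinear
discrete-time subsystems with radially unbounded storage functions, coupled through
`u = Hy`: if `Q + SH + HᵀSᵀ + HᵀRH ≺ 0`, the origin of the network `x⁺ = F(x)` is
globally asymptotically stable. -/
theorem network_global_asymptotic_stability_nonlinear {N n m p : ℕ}
    (f : Fin N → (Fin n → ℝ) → (Fin m → ℝ) → (Fin n → ℝ))
    (hfc : ∀ i, Continuous fun q : (Fin n → ℝ) × (Fin m → ℝ) => f i q.1 q.2)
    (hf0 : ∀ i, f i 0 0 = 0)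
    (h : Fin N → (Fin n → ℝ) → (Fin p → ℝ))
    (hhc : ∀ i, Continuous (h i)) (hh0 : ∀ i, h i 0 = 0)
    (H : Matrix (Fin N × Fin m) (Fin N × Fin p) ℝ)
    (F : (Fin N × Fin n → ℝ) → (Fin N × Fin n → ℝ))
    (hF : ∀ (x : Fin N × Fin n → ℝ) (i : Fin N) (a : Fin n),
      F x (i, a) =
        f i (fun b => x (i, b))
          (fun c =>
            (H *ᵥ fun jp : Fin N × Fin p => h jp.1 (fun b => x (jp.1, b)) jp.2) (i, c)) a)
    (Q : Fin N → Matrix (Fin p) (Fin p) ℝ)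
    (S : Fin N → Matrix (Fin p) (Fin m) ℝ)
    (R : Fin N → Matrix (Fin m) (Fin m) ℝ)
    (hQsymm : ∀ i, (Q i).IsSymm) (hRsymm : ∀ i, (R i).IsSymm)
    (V : Fin N → (Fin n → ℝ) → ℝ)
    (hVc : ∀ i, Continuous (V i)) (hV0 : ∀ i, V i 0 = 0)
    (hVpos : ∀ i (ξ : Fin n → ℝ), ξ ≠ 0 → 0 < V i ξ)
    (hVrad : ∀ i, Filter.Tendsto (V i) (Filter.comap norm Filter.atTop) Filter.atTop)
    (hdiss : ∀ i (ξ : Fin n → ℝ) (v : Fin m → ℝ),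
      V i (f i ξ v) - V i ξ ≤
        h i ξ ⬝ᵥ (Q i *ᵥ h i ξ) + 2 * (h i ξ ⬝ᵥ (S i *ᵥ v)) + v ⬝ᵥ (R i *ᵥ v))
    (hLMI : (-(blkDiag Q + blkDiag S * H + Hᵀ * (blkDiag S)ᵀ
        + Hᵀ * blkDiag R * H)).PosDef)
    (hzsd : ∀ i, ∀ ξ : ℕ → (Fin n → ℝ),
      (∀ k, ξ (k + 1) = f i (ξ k) 0) → (∀ k, h i (ξ k) = 0) →
      Filter.Tendsto ξ Filter.atTop (nhds 0)) :
    (F 0 = 0 ∧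
      ∀ ε > (0 : ℝ), ∃ δ > (0 : ℝ), ∀ x0 : Fin N × Fin n → ℝ,
        ‖x0‖ ≤ δ → ∀ k : ℕ, ‖F^[k] x0‖ ≤ ε) ∧
    ∀ x0 : Fin N × Fin n → ℝ,
      Filter.Tendsto (fun k : ℕ => F^[k] x0) Filter.atTop (nhds 0) := by
  have hVnn : ∀ i ξ, 0 ≤ V i ξ := fun i ξ => by
    by_cases hξ : ξ = 0
    · rw [hξ, hV0]
    · exact (hVpos i ξ hξ).le
  have hblock : ∀ i : Fin N, Continuous fun (x : Fin N × Fin n → ℝ) b => x (i, b) :=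
    fun i => by fun_prop
  set y : (Fin N × Fin n → ℝ) → Fin N × Fin p → ℝ :=
    fun x jp => h jp.1 (fun b => x (jp.1, b)) jp.2
  have hyc : Continuous y := continuous_pi fun jp =>
    (continuous_apply jp.2).comp ((hhc jp.1).comp (hblock jp.1))
  have hFi : ∀ x i, (fun a => F x (i, a)) =
      f i (fun b => x (i, b)) (fun c => (H *ᵥ y x) (i, c)) := fun x i => funext fun a => hF x i a
  have hFc : Continuous F := continuous_pi fun ⟨i, a⟩ => by
    have hu : Continuous fun x c => (H *ᵥ y x) (i, c) := continuous_pi fun c =>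
      (continuous_apply (i, c)).comp (continuous_const.matrix_mulVec hyc)
    simp only [hF]
    exact (continuous_apply a).comp ((hfc i).comp ((hblock i).prodMk hu))
  set M := blkDiag Q + blkDiag S * H + Hᵀ * (blkDiag S)ᵀ + Hᵀ * blkDiag R * H with hM
  set W : (Fin N × Fin n → ℝ) → ℝ := fun x => ∑ i, V i fun a => x (i, a) with hW
  have hstep : ∀ x, W (F x) - W x ≤ y x ⬝ᵥ (M *ᵥ y x) := fun x => by
    rw [hM, dotProduct_closedLoop_mulVec]
    simp only [dotProduct_blkDiag_mulVec, hW, hFi, Finset.mul_sum, ← Finset.sum_sub_distrib,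
      ← Finset.sum_add_distrib]
    exact Finset.sum_le_sum fun i _ => hdiss i _ _
  have hneg : ∀ v : Fin N × Fin p → ℝ, v ≠ 0 → v ⬝ᵥ (M *ᵥ v) < 0 := fun v hv => by
    have := hLMI.dotProduct_mulVec_pos hv
    simpa [neg_mulVec] using this
  have hdec : ∀ x, W (F x) ≤ W x := fun x => by
    have h₁ := hstep x
    by_cases hx : y x = 0
    · rw [hx, zero_dotProduct] at h₁
      linarith
    · linarith [hneg _ hx]
  refine globally_asymptotically_stable_of_lyapunov hFc (W := W)
    (continuous_finsetSum _ fun i _ => (hVc i).comp (hblock i))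
    (Finset.sum_eq_zero fun i _ => hV0 i) (fun x hx => ?_)
    (tendsto_sum_blocks_cocompact hVnn hVrad) hdec fun x hx => ?_
  · obtain ⟨⟨i, a⟩, hia⟩ := Function.ne_iff.mp hx
    exact Finset.sum_pos' (fun j _ => hVnn j _) ⟨i, Finset.mem_univ i, hVpos i _ fun h₀ =>
      hia (congrFun h₀ a)⟩
  · have hyk : ∀ k, y (F^[k] x) = 0 := fun k => by
      by_contra hne
      have h₁ := hstep (F^[k] x)
      rw [← Function.iterate_succ_apply' F, hx, hx] at h₁
      linarith [hneg _ hne]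
    refine tendsto_pi_nhds.mpr fun ⟨i, a⟩ => ?_
    refine tendsto_pi_nhds.mp (hzsd i (fun k b => (F^[k] x) (i, b)) (fun k => ?_)
      fun k => ?_) a
    · simp only [Function.iterate_succ_apply', hFi, hyk, mulVec_zero]
      rfl
    · exact funext fun c => congrFun (hyk k) (i, c)
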